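/- arXiv:1901.07908 — 2 statements merged into one kernel-verified Lean document; each statement's English description precedes it below -/
import Mathlib

section
/- Let d ≥ 2 be an integer and let r ≤ d−2 be an integer (possibly negative) with gcd(r,d)=1. Then for every positive integer n with n ≡ −r (mod d) and n ≥ d−r, the truncated sum ∑_{k=0}^{n−1} (q^r;q^d)_k^d · q^{dk} / (q^d;q^d)_k^d, viewed as a rational function of q over ℚ, is congruent to 0 modulo Φ_n(q)^2. -/
open Finset Polynomial

/-- The q-shifted factorial `(x; q)_k = ∏_{j=0}^{k-1} (1 - x q^j)` in `RatFunc ℚ`. -/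
noncomputable def qPoch (x q : RatFunc ℚ) (k : ℕ) : RatFunc ℚ :=
  ∏ j ∈ Finset.range k, (1 - x * q ^ j)

/-- `A ≡ 0 (mod P)`: `A = P · B` for some rational function `B` whose denominator
(in lowest terms) is coprime to `P`. -/
def CongrZero (A : RatFunc ℚ) (P : Polynomial ℚ) : Prop :=
  ∃ B : RatFunc ℚ, A = algebraMap (Polynomial ℚ) (RatFunc ℚ) P * B ∧ IsCoprime B.denom P

theorem qPoch_succ (x q : RatFunc ℚ) (k : ℕ) :
    qPoch x q (k + 1) = qPoch x q k * (1 - x * q ^ k) :=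
  Finset.prod_range_succ _ _

theorem qPoch_succ' (x q : RatFunc ℚ) (k : ℕ) :
    qPoch x q (k + 1) = (1 - x) * qPoch (x * q) q k := by
  simp only [qPoch, Finset.prod_range_succ', pow_zero, mul_one]
  rw [mul_comm]
  congr 1
  exact Finset.prod_congr rfl fun j _ => by ring

theorem qPoch_add (x q : RatFunc ℚ) (k l : ℕ) :
    qPoch x q (k + l) = qPoch x q k * qPoch (x * q ^ k) q l := by
  simp only [qPoch, Finset.prod_range_add]
  congr 1
  exact Finset.prod_congr rfl fun j _ => by ring

theorem qPoch_self_ne_zero {p : RatFunc ℚ} {k : ℕ}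
    (hp : ∀ j, 0 < j → j ≤ k → 1 - p ^ j ≠ 0) : qPoch p p k ≠ 0 := by
  refine Finset.prod_ne_zero_iff.2 fun j hj => ?_
  rw [← pow_succ']
  exact hp _ j.succ_pos (Finset.mem_range.1 hj)

theorem qPoch_inv_pow_eq_zero {p : RatFunc ℚ} (hp0 : p ≠ 0) {N k : ℕ} (h : N < k) :
    qPoch (p⁻¹ ^ N) p k = 0 :=
  Finset.prod_eq_zero (Finset.mem_range.2 h) (by rw [← mul_pow, inv_mul_cancel₀ hp0]; simp)

/-- The terminating `q`-binomial theorem. -/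
theorem sum_qPoch_inv_pow {p : RatFunc ℚ} (hp0 : p ≠ 0) (z : RatFunc ℚ) (N M : ℕ) (hNM : N < M)
    (hp : ∀ j, 0 < j → j < M → 1 - p ^ j ≠ 0) :
    ∑ k ∈ range M, qPoch (p⁻¹ ^ N) p k / qPoch p p k * z ^ k
      = ∏ i ∈ range N, (1 - z * p⁻¹ ^ (i + 1)) := by
  induction N with
  | zero =>
    rw [Finset.sum_eq_single 0]
    · simp [qPoch]
    · intro k _ hk
      rw [qPoch_inv_pow_eq_zero hp0 (Nat.pos_of_ne_zero hk)]
      simp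
    · simp [hNM]
  | succ N ih =>
    obtain ⟨M, rfl⟩ : ∃ M', M = M' + 1 := ⟨M - 1, by omega⟩
    have ih := ih (by omega)
    have hlast := ih
    rw [Finset.sum_range_succ, qPoch_inv_pow_eq_zero hp0 (by omega : N < M)] at hlast
    rw [Finset.prod_range_succ, mul_sub, mul_one]
    nth_rewrite 1 [← ih]
    rw [← hlast, Finset.sum_range_succ', Finset.sum_range_succ' _ M]
    simp only [zero_div, zero_mul, add_zero]
    rw [Finset.sum_mul, add_sub_right_comm, ← Finset.sum_sub_distrib]
    congr 1
    refine Finset.sum_congr rfl fun k hk => ?_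
    have hk := Finset.mem_range.1 hk
    have h1 : qPoch p p k ≠ 0 := qPoch_self_ne_zero fun j h0 h => hp j h0 (by omega)
    have h2 : 1 - p * p ^ k ≠ 0 := by
      rw [← pow_succ']; exact hp _ k.succ_pos (by omega)
    have h3 : p⁻¹ ^ (N + 1) * p = p⁻¹ ^ N := by
      rw [pow_succ, mul_assoc, inv_mul_cancel₀ hp0, mul_one]
    rw [qPoch_succ' (p⁻¹ ^ (N + 1)), h3, qPoch_succ, qPoch_succ]
    rw [← h3]
    field_simp
    ring

theorem sum_qPoch_inv_pow_mul_eval {p : RatFunc ℚ} (hp0 : p ≠ 0) {N M : ℕ} (hNM : N < M)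
    (hp : ∀ j, 0 < j → j < M → 1 - p ^ j ≠ 0) (g : (RatFunc ℚ)[X]) (hg : g.natDegree < N) :
    ∑ k ∈ range M, qPoch (p⁻¹ ^ N) p k / qPoch p p k * p ^ k * g.eval (p ^ k) = 0 := by
  simp_rw [Polynomial.eval_eq_sum_range' hg, Finset.mul_sum]
  rw [Finset.sum_comm]
  refine Finset.sum_eq_zero fun i hi => ?_
  have h := sum_qPoch_inv_pow hp0 (p ^ (i + 1)) N M hNM hp
  rw [Finset.prod_eq_zero hi (by rw [← mul_pow, mul_inv_cancel₀ hp0]; simp)] at h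
  calc _ = g.coeff i * ∑ k ∈ range M,
          qPoch (p⁻¹ ^ N) p k / qPoch p p k * (p ^ (i + 1)) ^ k := by
        rw [Finset.mul_sum]
        exact Finset.sum_congr rfl fun k _ => by ring
    _ = 0 := by rw [h, mul_zero]

/-- A `q`-Karlsson–Minton type summation. -/
theorem sum_qPoch_karlsson_minton {p : RatFunc ℚ} (hp0 : p ≠ 0) {N M m D : ℕ} (hNM : N < M)
    (hmM : m < M) (hD : m * D < N) (hp : ∀ j, 0 < j → j < M → 1 - p ^ j ≠ 0) :
    ∑ k ∈ range M, qPoch (p⁻¹ ^ N) p k * qPoch (p ^ (m + 1)) p k ^ D * p ^ k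
      / qPoch p p k ^ (D + 1) = 0 := by
  have hne : ∀ k, k < M → qPoch p p k ≠ 0 := fun k hk =>
    qPoch_self_ne_zero fun j h0 h => hp j h0 (by omega)
  let g : (RatFunc ℚ)[X] :=
    (C (qPoch p p m)⁻¹ * ∏ i ∈ range m, (1 - C (p ^ (i + 1)) * X)) ^ D
  have hg : g.natDegree < N := by
    refine lt_of_le_of_lt ?_ hD
    rw [mul_comm]
    refine natDegree_pow_le_of_le D ((natDegree_C_mul_le _ _).trans ?_)
    refine (natDegree_prod_le _ _).trans ((Finset.sum_le_card_nsmul _ _ 1 fun i _ => ?_).trans ?_)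
    · compute_degree
    · simp
  rw [← sum_qPoch_inv_pow_mul_eval hp0 hNM hp g hg]
  refine Finset.sum_congr rfl fun k hk => ?_
  have hk := hne k (Finset.mem_range.1 hk)
  have hm := hne m hmM
  have hprod : ∏ i ∈ range m, (1 - p ^ (i + 1) * p ^ k) = qPoch (p * p ^ k) p m :=
    Finset.prod_congr rfl fun i _ => by ring
  have hcomm : qPoch p p m * qPoch (p ^ (m + 1)) p k = qPoch p p k * qPoch (p * p ^ k) p m := by
    rw [pow_succ', ← qPoch_add, ← qPoch_add, add_comm]
  have heval : g.eval (p ^ k) = (qPoch (p ^ (m + 1)) p k / qPoch p p k) ^ D := by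
    simp only [g, eval_pow, eval_mul, eval_C, eval_prod, eval_sub, eval_one, eval_X]
    rw [hprod]
    congr 1
    field_simp
    linear_combination -hcomm
  rw [heval, div_pow]
  field_simp
  ring

theorem add_pow_of_sq_eq_zero {R : Type*} [CommRing R] (a : R) {c : R} (hc : c ^ 2 = 0) (k : ℕ) :
    (a + c) ^ (k + 1) = a ^ (k + 1) + (k + 1) * a ^ k * c := by
  induction k with
  | zero => simp
  | succ k ih =>
    rw [pow_succ, ih]
    push_cast
    linear_combination (k + 1) * a ^ k * hc

theorem eval_one_add_of_sq_eq_zero {R : Type*} [CommRing R] (f : R[X]) {e : R} (he : e ^ 2 = 0)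
    (k : ℕ) : f.eval ((1 + e) ^ k) = f.eval 1 + f.derivative.eval 1 * (k * e) := by
  have h : (1 + e) ^ k = 1 + k * e := by
    cases k with
    | zero => simp
    | succ k => rw [add_pow_of_sq_eq_zero 1 he]; simp
  obtain ⟨c, hc⟩ := f.binomExpansion 1 (k * e)
  rw [h, hc, mul_pow, he]
  ring

theorem eval_pow_eq_of_sq_eq_zero {R : Type*} [CommRing R] (f : R[X]) {e : R} (he : e ^ 2 = 0)
    (D : ℕ) : f.eval ((1 + e) ^ D) ^ (D + 1)
      = f.eval 1 * f.eval ((1 + e) ^ (D + 1)) ^ D := by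
  have hsq (k : ℕ) : (f.derivative.eval 1 * (k * e)) ^ 2 = 0 := by
    linear_combination (f.derivative.eval 1 * k) ^ 2 * he
  rw [eval_one_add_of_sq_eq_zero f he, eval_one_add_of_sq_eq_zero f he,
    add_pow_of_sq_eq_zero _ (hsq _)]
  cases D with
  | zero => simp
  | succ D =>
    rw [add_pow_of_sq_eq_zero _ (hsq _)]
    push_cast
    ring

theorem sq_dvd_eval_pow_sub {R : Type*} [CommRing R] (f : R[X]) {φ x : R} (h : φ ∣ x - 1)
    (D : ℕ) : φ ^ 2 ∣ f.eval (x ^ D) ^ (D + 1) - f.eval 1 * f.eval (x ^ (D + 1)) ^ D := by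
  rw [← Ideal.mem_span_singleton, ← Ideal.Quotient.eq]
  set π := Ideal.Quotient.mk (Ideal.span {φ ^ 2})
  have he : π (x - 1) ^ 2 = 0 := by
    rw [← map_pow, Ideal.Quotient.eq_zero_iff_mem, Ideal.mem_span_singleton]
    exact pow_dvd_pow_of_dvd h 2
  have hx : π x = 1 + π (x - 1) := by simp
  have hev (y : R) : π (f.eval y) = (f.map π).eval (π y) := (eval_map_apply π y).symm
  simp only [map_mul, map_pow, hev, hx, map_one]
  exact eval_pow_eq_of_sq_eq_zero _ he D

/-- The rational functions whose denominator is coprime to `P`. -/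
def coprimeDenomSubring (P : ℚ[X]) : Subring (RatFunc ℚ) where
  carrier := {A | IsCoprime A.denom P}
  mul_mem' ha hb := (IsCoprime.mul_left ha hb).of_isCoprime_of_dvd_left (RatFunc.denom_mul_dvd _ _)
  add_mem' ha hb := (IsCoprime.mul_left ha hb).of_isCoprime_of_dvd_left (RatFunc.denom_add_dvd _ _)
  one_mem' := by simp [isCoprime_one_left]
  zero_mem' := by simp [isCoprime_one_left]
  neg_mem' {a} ha := by
    refine IsCoprime.of_isCoprime_of_dvd_left ha ?_
    rw [RatFunc.denom_dvd a.denom_ne_zero]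
    exact ⟨-a.num, by rw [map_neg, neg_div, RatFunc.num_div_denom]⟩

theorem algebraMap_mem_coprimeDenomSubring (P a : ℚ[X]) :
    algebraMap ℚ[X] (RatFunc ℚ) a ∈ coprimeDenomSubring P := by
  change IsCoprime _ _
  simp [isCoprime_one_left]

theorem inv_algebraMap_mem_coprimeDenomSubring {P a : ℚ[X]} (ha : a ≠ 0) (h : IsCoprime a P) :
    (algebraMap ℚ[X] (RatFunc ℚ) a)⁻¹ ∈ coprimeDenomSubring P := by
  refine IsCoprime.of_isCoprime_of_dvd_left h ?_
  rw [RatFunc.denom_dvd ha]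
  exact ⟨1, by simp⟩

theorem isCoprime_X_cyclotomic (n : ℕ) (hn : 0 < n) :
    IsCoprime (X : ℚ[X]) (cyclotomic n ℚ) := by
  obtain ⟨c, hc⟩ := cyclotomic.dvd_X_pow_sub_one n ℚ
  refine ⟨X ^ (n - 1), -c, ?_⟩
  rw [← pow_succ, Nat.sub_add_cancel hn]
  linear_combination hc

theorem isCoprime_one_sub_X_pow_cyclotomic {n k : ℕ} (hn : 0 < n) (h : ¬ n ∣ k) :
    IsCoprime (1 - X ^ k : ℚ[X]) (cyclotomic n ℚ) := by
  refine ((cyclotomic.irreducible_rat hn).coprime_iff_not_dvd.2 fun hdvd => h ?_).symm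
  have hζ := Complex.isPrimitiveRoot_exp n hn.ne'
  obtain ⟨c, hc⟩ := hdvd
  have h0 : aeval (Complex.exp (2 * Real.pi * Complex.I / n)) (cyclotomic n ℚ) = 0 := by
    rw [aeval_def, eval₂_eq_eval_map, map_cyclotomic]
    exact hζ.isRoot_cyclotomic hn
  have h1 := congrArg (aeval (Complex.exp (2 * Real.pi * Complex.I / n))) hc
  rw [map_mul, h0, zero_mul] at h1
  simp only [map_sub, map_one, map_pow, aeval_X] at h1
  exact hζ.dvd_of_pow_eq_one _ (sub_eq_zero.1 h1).symm

theorem exists_qPoch_pow_eq (O : Subring (RatFunc ℚ)) {p s x φ : RatFunc ℚ} (hp : p ∈ O)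
    (hs : s ∈ O) (hx : x ∈ O) (hφ : φ ∈ O) (h : ∃ c ∈ O, x - 1 = φ * c) (D k : ℕ) :
    ∃ B ∈ O, qPoch (s * x ^ D) p k ^ (D + 1)
      = qPoch s p k * qPoch (s * x ^ (D + 1)) p k ^ D + φ ^ 2 * B := by
  obtain ⟨c, hc, hxc⟩ := h
  lift p to O using hp
  lift s to O using hs
  lift x to O using hx
  lift φ to O using hφ
  lift c to O using hc
  let f : O[X] := ∏ j ∈ range k, (1 - C (s * p ^ j) * X)
  have hf (y : O) : ((f.eval y : O) : RatFunc ℚ) = qPoch (s * y) p k := by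
    simp only [f, eval_prod, eval_sub, eval_one, eval_mul, eval_C, eval_X, qPoch]
    push_cast
    exact Finset.prod_congr rfl fun j _ => by ring
  obtain ⟨b, hb⟩ := sq_dvd_eval_pow_sub f (φ := φ) (x := x) ⟨c, by exact_mod_cast hxc⟩ D
  refine ⟨b, b.2, ?_⟩
  have hb := congrArg (Subtype.val) hb
  push_cast at hb
  rw [hf, hf, hf] at hb
  push_cast at hb
  rw [mul_one] at hb
  linear_combination hb

theorem stmt0 (d : ℕ) (hd : 2 ≤ d) (r : ℤ) (hr : r ≤ (d : ℤ) - 2)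
    (hgcd : Int.gcd r d = 1) (n : ℕ) (hn : 0 < n)
    (hmod : (n : ℤ) ≡ -r [ZMOD (d : ℤ)])
    (hge : (d : ℤ) - r ≤ (n : ℤ)) :
    CongrZero
      (∑ k ∈ Finset.range n,
        (qPoch ((RatFunc.X : RatFunc ℚ) ^ r) (RatFunc.X ^ d) k) ^ d * RatFunc.X ^ (d * k)
          / (qPoch ((RatFunc.X : RatFunc ℚ) ^ d) (RatFunc.X ^ d) k) ^ d)
      ((Polynomial.cyclotomic n ℚ) ^ 2) := by
  obtain ⟨D, rfl⟩ : ∃ D, d = D + 1 := ⟨d - 1, by omega⟩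
  obtain ⟨m', hm'⟩ : ((D + 1 : ℕ) : ℤ) ∣ n + r := by
    have h := hmod.symm.dvd
    rwa [sub_neg_eq_add] at h
  have hm1 : 1 ≤ m' := by
    by_contra! hlt
    push_cast at *
    nlinarith
  obtain ⟨m, rfl⟩ : ∃ m : ℕ, m' = m + 1 := ⟨(m' - 1).toNat, by omega⟩
  push_cast at hm' hr hge
  have hD : 1 ≤ D := by omega
  have hlt : m + 1 < n := by
    zify at hD ⊢
    nlinarith
  obtain ⟨N, hN⟩ : ∃ N, n = N + (m + 1) := ⟨n - (m + 1), by omega⟩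
  have hdeg : m * D < N := by
    zify at hN ⊢
    nlinarith
  have hcop : Nat.Coprime n (D + 1) := by
    rw [← Nat.isCoprime_iff_coprime]
    have h : (n : ℤ) = -r + (m + 1) * ((D + 1 : ℕ) : ℤ) := by push_cast; linarith
    rw [h, IsCoprime.add_mul_right_left_iff, IsCoprime.neg_left_iff]
    exact Int.isCoprime_iff_gcd_eq_one.2 hgcd
  set q : RatFunc ℚ := RatFunc.X with hq
  have hq0 : q ≠ 0 := RatFunc.X_ne_zero
  let O := coprimeDenomSubring (cyclotomic n ℚ)
  have hqa : q = algebraMap ℚ[X] (RatFunc ℚ) X := RatFunc.algebraMap_X.symm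
  have hqO : q ∈ O := hqa ▸ algebraMap_mem_coprimeDenomSubring _ _
  have hqO' : q⁻¹ ∈ O :=
    hqa ▸ inv_algebraMap_mem_coprimeDenomSubring X_ne_zero (isCoprime_X_cyclotomic n hn)
  have hunit (j : ℕ) (h0 : 0 < j) (hj : j < n) :
      1 - (q ^ (D + 1)) ^ j ≠ 0 ∧ (1 - (q ^ (D + 1)) ^ j)⁻¹ ∈ O := by
    have hk : 0 < (D + 1) * j := by positivity
    have hne : (1 - X ^ ((D + 1) * j) : ℚ[X]) ≠ 0 := by
      rw [← neg_sub]
      exact neg_ne_zero.2 (X_pow_sub_C_ne_zero hk 1)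
    have heq : 1 - (q ^ (D + 1)) ^ j
        = algebraMap ℚ[X] (RatFunc ℚ) (1 - X ^ ((D + 1) * j)) := by
      rw [hqa, map_sub, map_one, map_pow, pow_mul]
    rw [heq]
    refine ⟨RatFunc.algebraMap_ne_zero hne, inv_algebraMap_mem_coprimeDenomSubring hne
      (isCoprime_one_sub_X_pow_cyclotomic hn fun h => ?_)⟩
    exact absurd (Nat.le_of_dvd h0 (hcop.dvd_of_dvd_mul_left h)) (by omega)
  set φ := algebraMap ℚ[X] (RatFunc ℚ) (cyclotomic n ℚ) with hφ
  have hφO : φ ∈ O := algebraMap_mem_coprimeDenomSubring _ _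
  have hdvd : ∃ c ∈ O, q ^ n - 1 = φ * c := by
    obtain ⟨c, hc⟩ := cyclotomic.dvd_X_pow_sub_one n ℚ
    refine ⟨_, algebraMap_mem_coprimeDenomSubring _ c, ?_⟩
    rw [hφ, hqa, ← map_mul, ← hc, map_sub, map_pow, map_one]
  set p := q ^ (D + 1) with hp
  have hp0 : p ≠ 0 := pow_ne_zero _ hq0
  have hpO : p ∈ O := pow_mem hqO _
  have hsO : p⁻¹ ^ N ∈ O := by
    rw [hp, ← inv_pow]
    exact pow_mem (pow_mem hqO' _) _
  have hqr : q ^ r = p⁻¹ ^ N * (q ^ n) ^ D := by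
    have hr' : r = -((D + 1) * N) + n * D := by
      zify at hN
      linear_combination hm' - (D + 1) * hN
    rw [hr', zpow_add₀ hq0, zpow_neg, hp, inv_pow, ← pow_mul, ← pow_mul]
    norm_cast
  have hpm : p⁻¹ ^ N * (q ^ n) ^ (D + 1) = p ^ (m + 1) := by
    rw [← pow_mul, mul_comm n, pow_mul, ← hp, hN, pow_add, ← mul_assoc, ← mul_pow,
      inv_mul_cancel₀ hp0, one_pow, one_mul]
  choose B hBO hB using exists_qPoch_pow_eq O hpO hsO (pow_mem hqO n) hφO hdvd D
  rw [hpm, ← hqr] at hB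
  have hinv (k : ℕ) (hk : k < n) : (qPoch p p k)⁻¹ ∈ O := by
    rw [qPoch, ← Finset.prod_inv_distrib]
    refine prod_mem fun j hj => ?_
    rw [← pow_succ']
    exact (hunit _ j.succ_pos (by have := Finset.mem_range.1 hj; omega)).2
  refine ⟨∑ k ∈ range n, B k * p ^ k * (qPoch p p k)⁻¹ ^ (D + 1), ?_,
    IsCoprime.pow_right (sum_mem (S := O) fun k hk => ?_)⟩
  · have h0 := sum_qPoch_karlsson_minton hp0 (by omega : N < n) (by omega : m < n) hdeg
      fun j h0 hj => (hunit j h0 hj).1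
    rw [← zero_add (_ * _), ← h0, map_pow, Finset.mul_sum, ← Finset.sum_add_distrib]
    refine Finset.sum_congr rfl fun k _ => ?_
    rw [hB, pow_mul]
    ring
  · exact mul_mem (mul_mem (hBO k) (pow_mem hpO k))
      (pow_mem (hinv k (Finset.mem_range.1 hk)) _)
end

section
/- Let n > 1 be an odd positive integer. Then the shorter truncation ∑_{k=0}^{(n+1)/2} (q^{−1};q^2)_k^2 · q^{2k} / (q^2;q^2)_k^2 ≡ 0 (mod [n]·Φ_n(q)), as rational functions of q over ℚ, where [n] = 1 + q + ⋯ + q^{n−1}. -/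
open Finset Polynomial

/-- The rational functions whose reduced denominator is coprime to `P`. -/
def localSubring (P : ℚ[X]) : Subring (RatFunc ℚ) where
  carrier := {A | IsCoprime A.denom P}
  mul_mem' {A B} hA hB := (hA.mul_left hB).of_isCoprime_of_dvd_left (RatFunc.denom_mul_dvd A B)
  one_mem' := by simpa using isCoprime_one_left
  add_mem' {A B} hA hB := (hA.mul_left hB).of_isCoprime_of_dvd_left (RatFunc.denom_add_dvd A B)
  zero_mem' := by simpa using isCoprime_one_left
  neg_mem' {A} hA := by
    have h := RatFunc.denom_mul_dvd (algebraMap ℚ[X] (RatFunc ℚ) (-1)) A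
    rw [RatFunc.denom_algebraMap, one_mul] at h
    simpa using IsCoprime.of_isCoprime_of_dvd_left hA h

theorem algebraMap_mem_localSubring (P p : ℚ[X]) :
    algebraMap ℚ[X] (RatFunc ℚ) p ∈ localSubring P := by
  change IsCoprime _ _
  simpa using isCoprime_one_left

theorem inv_algebraMap_mem_localSubring {P p : ℚ[X]} (h : IsCoprime p P) :
    (algebraMap ℚ[X] (RatFunc ℚ) p)⁻¹ ∈ localSubring P := by
  have h1 := RatFunc.denom_div_dvd (1 : ℚ[X]) p
  rw [map_one, one_div] at h1
  exact h.of_isCoprime_of_dvd_left h1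

theorem X_mem_localSubring (P : ℚ[X]) : (RatFunc.X : RatFunc ℚ) ∈ localSubring P := by
  simpa using algebraMap_mem_localSubring P X

section CongrZero

variable {P : ℚ[X]} {A B : RatFunc ℚ}

theorem CongrZero.zero : CongrZero 0 P := ⟨0, by simp, (localSubring P).zero_mem⟩

theorem CongrZero.add (hA : CongrZero A P) (hB : CongrZero B P) : CongrZero (A + B) P := by
  obtain ⟨A', rfl, hA'⟩ := hA
  obtain ⟨B', rfl, hB'⟩ := hB
  exact ⟨A' + B', by ring, (localSubring P).add_mem hA' hB'⟩

theorem CongrZero.mul_left (hA : A ∈ localSubring P) (hB : CongrZero B P) :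
    CongrZero (A * B) P := by
  obtain ⟨B', rfl, hB'⟩ := hB
  exact ⟨A * B', by ring, (localSubring P).mul_mem hA hB'⟩

theorem CongrZero.sum {ι : Type*} {s : Finset ι} {f : ι → RatFunc ℚ}
    (h : ∀ i ∈ s, CongrZero (f i) P) : CongrZero (∑ i ∈ s, f i) P :=
  Finset.sum_induction _ (CongrZero · P) (fun _ _ => CongrZero.add) CongrZero.zero h

theorem CongrZero.prod_sub_prod {ι : Type*} {s : Finset ι} {f g : ι → RatFunc ℚ}
    (hf : ∀ i ∈ s, f i ∈ localSubring P) (hg : ∀ i ∈ s, g i ∈ localSubring P)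
    (h : ∀ i ∈ s, CongrZero (f i - g i) P) :
    CongrZero (∏ i ∈ s, f i - ∏ i ∈ s, g i) P := by
  classical
  induction s using Finset.induction_on with
  | empty => simpa using CongrZero.zero
  | insert a s ha ih =>
    simp only [Finset.forall_mem_insert] at hf hg h
    rw [prod_insert ha, prod_insert ha, show f a * ∏ i ∈ s, f i - g a * ∏ i ∈ s, g i =
      f a * (∏ i ∈ s, f i - ∏ i ∈ s, g i) + (∏ i ∈ s, g i) * (f a - g a) by ring]
    exact (CongrZero.mul_left hf.1 (ih hf.2 hg.2 h.2)).add
      (CongrZero.mul_left (Subring.prod_mem _ hg.2) h.1)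

theorem CongrZero.of_dvd {p : ℚ[X]} (h : P ∣ p) :
    CongrZero (algebraMap ℚ[X] (RatFunc ℚ) p) P := by
  obtain ⟨r, rfl⟩ := h
  exact ⟨algebraMap _ _ r, by simp, algebraMap_mem_localSubring P r⟩

theorem CongrZero.mono {P' : ℚ[X]} (h : P' ∣ P) (hA : CongrZero A P) : CongrZero A P' := by
  obtain ⟨B, rfl, hB⟩ := hA
  obtain ⟨R, rfl⟩ := h
  refine ⟨algebraMap _ _ R * B, by rw [map_mul]; ring, ?_⟩
  exact (localSubring P').mul_mem (algebraMap_mem_localSubring _ _) hB.of_mul_right_left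

theorem congrZero_iff : CongrZero A P ↔ P ∣ A.num ∧ IsCoprime A.denom P := by
  constructor
  · rintro ⟨B, hA, hB⟩
    have hden : IsCoprime A.denom P := by
      rw [hA]
      exact (localSubring P).mul_mem (algebraMap_mem_localSubring _ _) hB
    refine ⟨?_, hden⟩
    have h : A.num * B.denom = P * B.num * A.denom := by
      have hA0 := RatFunc.algebraMap_ne_zero A.denom_ne_zero
      have hB0 := RatFunc.algebraMap_ne_zero B.denom_ne_zero
      apply RatFunc.algebraMap_injective ℚ
      have h1 := RatFunc.num_div_denom A
      have h2 := RatFunc.num_div_denom B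
      rw [div_eq_iff hA0] at h1
      rw [div_eq_iff hB0] at h2
      simp only [map_mul]
      rw [h1, h2, hA]
      ring
    exact hB.symm.dvd_of_dvd_mul_right ⟨B.num * A.denom, by rw [h, mul_assoc]⟩
  · rintro ⟨⟨R, hR⟩, hden⟩
    refine ⟨algebraMap _ _ R * (algebraMap _ _ A.denom)⁻¹, ?_,
      (localSubring P).mul_mem (algebraMap_mem_localSubring _ _)
        (inv_algebraMap_mem_localSubring hden)⟩
    conv_lhs => rw [← RatFunc.num_div_denom A, hR]
    rw [map_mul]
    ring

theorem CongrZero.mul_modulus {P₁ P₂ : ℚ[X]} (h : IsCoprime P₁ P₂) (h₁ : CongrZero A P₁)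
    (h₂ : CongrZero A P₂) : CongrZero A (P₁ * P₂) := by
  rw [congrZero_iff] at *
  exact ⟨h.mul_dvd h₁.1 h₂.1, h₁.2.mul_right h₂.2⟩

theorem CongrZero.prod_modulus {ι : Type*} {s : Finset ι} {P : ι → ℚ[X]}
    (hcop : (s : Set ι).Pairwise (Function.onFun IsCoprime P)) (h : ∀ i ∈ s, CongrZero A (P i)) : CongrZero A (∏ i ∈ s, P i) := by
  simp only [congrZero_iff] at *
  exact ⟨Finset.prod_dvd_of_coprime hcop fun i hi => (h i hi).1,
    IsCoprime.prod_right fun i hi => (h i hi).2⟩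

end CongrZero

section Cyclotomic

variable {d : ℕ}

theorem isCoprime_cyclotomic_of_aeval_ne_zero (hd : 0 < d) {p : ℚ[X]} {ζ : ℂ}
    (hζ : IsPrimitiveRoot ζ d) (h : aeval ζ p ≠ 0) : IsCoprime p (cyclotomic d ℚ) := by
  refine ((cyclotomic.irreducible_rat hd).coprime_iff_not_dvd.2 ?_).symm
  rintro ⟨r, rfl⟩
  apply h
  have h0 : aeval ζ (cyclotomic d ℚ) = 0 := by
    rw [aeval_def, eval₂_eq_eval_map, map_cyclotomic]
    have : NeZero (d : ℂ) := ⟨by exact_mod_cast hd.ne'⟩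
    exact isRoot_cyclotomic_iff.2 hζ
  rw [map_mul, h0, zero_mul]

theorem isCoprime_X_cyclotomic_s4 (hd : 0 < d) : IsCoprime (X : ℚ[X]) (cyclotomic d ℚ) :=
  isCoprime_cyclotomic_of_aeval_ne_zero hd (Complex.isPrimitiveRoot_exp d hd.ne')
    (by rw [aeval_X]; exact (Complex.isPrimitiveRoot_exp d hd.ne').ne_zero hd.ne')

theorem isCoprime_one_sub_X_pow_cyclotomic_s4 (hd : 0 < d) {m : ℕ} (hm : ¬ d ∣ m) :
    IsCoprime (1 - X ^ m : ℚ[X]) (cyclotomic d ℚ) := by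
  have hζ := Complex.isPrimitiveRoot_exp d hd.ne'
  refine isCoprime_cyclotomic_of_aeval_ne_zero hd hζ fun h => hm ?_
  simp only [map_sub, map_one, map_pow, aeval_X] at h
  exact hζ.dvd_of_pow_eq_one m (sub_eq_zero.1 h).symm

theorem isCoprime_geom_sum_cyclotomic (hd : 0 < d) {m : ℕ} (hm : m ≠ 0) :
    IsCoprime (∑ i ∈ range m, (X ^ d) ^ i : ℚ[X]) (cyclotomic d ℚ) := by
  have hζ := Complex.isPrimitiveRoot_exp d hd.ne'
  refine isCoprime_cyclotomic_of_aeval_ne_zero hd hζ ?_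
  simp [hζ.pow_eq_one, hm]

theorem cyclotomic_dvd_one_sub_X_pow {m : ℕ} (hm : d ∣ m) :
    cyclotomic d ℚ ∣ 1 - X ^ m := by
  rw [← neg_sub, dvd_neg]
  obtain ⟨e, rfl⟩ := hm
  refine (cyclotomic.dvd_X_pow_sub_one d ℚ).trans ?_
  simpa [pow_mul] using sub_dvd_pow_sub_pow (X ^ d : ℚ[X]) 1 e

variable {e : ℕ}

theorem X_zpow_mem_localSubring (hd : 0 < d) (m : ℤ) :
    (RatFunc.X : RatFunc ℚ) ^ m ∈ localSubring (cyclotomic d ℚ ^ e) := by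
  cases m with
  | ofNat m => simpa using pow_mem (X_mem_localSubring _) m
  | negSucc m =>
    rw [zpow_negSucc, ← inv_pow]
    refine pow_mem ?_ _
    simpa using inv_algebraMap_mem_localSubring
      ((isCoprime_X_cyclotomic_s4 hd).pow_right (n := e))

theorem inv_one_sub_X_pow_mem_localSubring (hd : 0 < d) {m : ℕ} (hm : ¬ d ∣ m) :
    (1 - (RatFunc.X : RatFunc ℚ) ^ m)⁻¹ ∈ localSubring (cyclotomic d ℚ ^ e) := by
  simpa using inv_algebraMap_mem_localSubring
      ((isCoprime_one_sub_X_pow_cyclotomic_s4 hd hm).pow_right (n := e))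

end Cyclotomic

theorem one_sub_X_pow_ne_zero {m : ℕ} (hm : m ≠ 0) : 1 - (RatFunc.X : RatFunc ℚ) ^ m ≠ 0 := by
  have h := isCoprime_one_sub_X_pow_cyclotomic_s4 (d := m + 1) (by omega) (m := m)
    (fun h => by have := Nat.le_of_dvd (by omega) h; omega)
  have h0 : (1 - X ^ m : ℚ[X]) ≠ 0 := by
    rintro h0
    rw [h0, isCoprime_zero_left] at h
    exact (cyclotomic.irreducible_rat (n := m + 1) (by omega)).not_isUnit h
  simpa using RatFunc.algebraMap_ne_zero h0

/-- Indefinite summation of `∑ (a;Q)_k (b;Q)_k Q^k / (Q;Q)_k^2` when `a b Q = 1`. -/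
theorem sum_prod_mul_pow_of_mul_eq_one {K : Type*} [Field K] {a b Q : K} (hab : a * b * Q = 1)
    (hQ : ∀ j : ℕ, 1 - Q ^ (j + 1) ≠ 0) (m : ℕ) :
    ((a + b) * Q - 1 - Q) ^ 2 * ∑ k ∈ range m,
        (∏ j ∈ range k, (1 - a * Q ^ j) * (1 - b * Q ^ j) / (1 - Q ^ (j + 1)) ^ 2) * Q ^ k =
      (1 - Q ^ m) ^ 2 *
        (∏ j ∈ range m, (1 - a * Q ^ j) * (1 - b * Q ^ j) / (1 - Q ^ (j + 1)) ^ 2) *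
        (Q * (2 - (a + b) * Q) + (Q - 1) * Q ^ m) := by
  induction m with
  | zero => simp
  | succ m ih =>
    rw [sum_range_succ, mul_add, ih, prod_range_succ]
    generalize ∏ j ∈ range m, (1 - a * Q ^ j) * (1 - b * Q ^ j) / (1 - Q ^ (j + 1)) ^ 2 = p
    have h : (1 - Q ^ (m + 1)) ^ 2 *
        (p * ((1 - a * Q ^ m) * (1 - b * Q ^ m) / (1 - Q ^ (m + 1)) ^ 2)) =
        p * ((1 - a * Q ^ m) * (1 - b * Q ^ m)) := by
      have := hQ m
      field_simp
    rw [h, pow_succ]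
    linear_combination
      -(p * (Q ^ m) ^ 2 * (2 - (a + b) * Q + (Q - 1) * Q ^ m)) * hab

/-- The quotient of consecutive values of `(q^{-1}; q^2)_k / (q^2; q^2)_k`. -/
noncomputable def ratio (j : ℕ) : RatFunc ℚ :=
  (1 - RatFunc.X ^ (2 * j - 1 : ℤ)) * (1 - RatFunc.X ^ (2 * (j + 1)))⁻¹

/-- The summand `(q^{-1}; q^2)_k^2 q^{2k} / (q^2; q^2)_k^2`. -/
noncomputable def summand (k : ℕ) : RatFunc ℚ :=
  (∏ j ∈ range k, ratio j) ^ 2 * RatFunc.X ^ (2 * k)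

theorem qPoch_div_eq_summand (k : ℕ) :
    (qPoch ((RatFunc.X : RatFunc ℚ) ^ (-1 : ℤ)) (RatFunc.X ^ 2) k) ^ 2 * RatFunc.X ^ (2 * k)
      / (qPoch ((RatFunc.X : RatFunc ℚ) ^ 2) (RatFunc.X ^ 2) k) ^ 2 = summand k := by
  have h1 : ∀ j : ℕ, (RatFunc.X : RatFunc ℚ) ^ (-1 : ℤ) * (RatFunc.X ^ 2) ^ j =
      RatFunc.X ^ (2 * j - 1 : ℤ) := fun j => by
    rw [← pow_mul, ← zpow_natCast, ← zpow_add₀ RatFunc.X_ne_zero]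
    congr 1
  have h2 : ∀ j : ℕ, (RatFunc.X : RatFunc ℚ) ^ 2 * (RatFunc.X ^ 2) ^ j =
      RatFunc.X ^ (2 * (j + 1)) := fun j => by ring
  simp only [qPoch, summand, ratio, h1, h2, prod_mul_distrib, prod_inv_distrib]
  ring

section Ratio

variable {d e : ℕ}

theorem not_dvd_two_mul (hodd : Odd d) {j : ℕ} (h : ¬ d ∣ j) : ¬ d ∣ 2 * j := fun h' =>
  h ((Nat.Coprime.dvd_mul_left (Nat.coprime_two_right.2 hodd)).1 h')

theorem one_sub_X_zpow_mem_localSubring (hd : 0 < d) (m : ℤ) :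
    1 - (RatFunc.X : RatFunc ℚ) ^ m ∈ localSubring (cyclotomic d ℚ ^ e) :=
  Subring.sub_mem _ (Subring.one_mem _) (X_zpow_mem_localSubring hd m)

theorem ratio_mem_localSubring (hodd : Odd d) {j : ℕ} (h : ¬ d ∣ j + 1) :
    ratio j ∈ localSubring (cyclotomic d ℚ ^ e) :=
  Subring.mul_mem _ (one_sub_X_zpow_mem_localSubring hodd.pos _)
    (inv_one_sub_X_pow_mem_localSubring hodd.pos (not_dvd_two_mul hodd h))

theorem congrZero_sum_summand_sq (hd : 1 < d) (hodd : Odd d) :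
    CongrZero (∑ k ∈ range ((d + 1) / 2 + 1), summand k) (cyclotomic d ℚ ^ 2) := by
  obtain ⟨N, rfl⟩ := hodd
  have hN : 0 < N := by omega
  have hodd : Odd (2 * N + 1) := ⟨N, rfl⟩
  have hX : (RatFunc.X : RatFunc ℚ) ≠ 0 := RatFunc.X_ne_zero
  rw [show (2 * N + 1 + 1) / 2 + 1 = N + 2 by omega]
  set x : RatFunc ℚ := RatFunc.X with hx
  let a : RatFunc ℚ := x ^ (2 * N : ℤ)
  let b : RatFunc ℚ := x ^ (-2 * N - 2 : ℤ)
  let f : ℕ → RatFunc ℚ := fun j =>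
    (1 - a * (x ^ 2) ^ j) * (1 - b * (x ^ 2) ^ j) / (1 - (x ^ 2) ^ (j + 1)) ^ 2
  have hab : a * b * x ^ 2 = 1 := by
    simp only [a, b]
    rw [← zpow_natCast, ← zpow_add₀ hX, ← zpow_add₀ hX]
    convert zpow_zero x using 2
    push_cast
    ring
  have hQ : ∀ j : ℕ, 1 - (x ^ 2) ^ (j + 1) ≠ 0 := fun j => by
    rw [← pow_mul]
    exact one_sub_X_pow_ne_zero (by omega)
  have hzero : ∑ k ∈ range (N + 2), (∏ j ∈ range k, f j) * (x ^ 2) ^ k = 0 := by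
    have h := sum_prod_mul_pow_of_mul_eq_one hab hQ (N + 2)
    have hb : 1 - b * (x ^ 2) ^ (N + 1) = 0 := by
      simp only [b]
      rw [← pow_mul, ← zpow_natCast, ← zpow_add₀ hX, sub_eq_zero]
      symm
      convert zpow_zero x using 2
      push_cast
      ring
    rw [prod_range_succ _ (N + 1), hb] at h
    simp only [mul_zero, zero_div, zero_mul] at h
    refine (mul_eq_zero.1 h).resolve_left (pow_ne_zero 2 ?_)
    have ha : a = (x ^ 2) ^ N := by
      simp only [a]
      rw [← pow_mul]
      exact_mod_cast rfl
    have hE : a * ((a + b) * x ^ 2 - 1 - x ^ 2) = (1 - a * x ^ 2) * (1 - a) := by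
      linear_combination hab
    intro h0
    rw [h0, mul_zero, eq_comm, mul_eq_zero] at hE
    rcases hE with hE | hE
    · rw [ha, ← pow_succ] at hE
      exact hQ _ hE
    · obtain ⟨M, rfl⟩ := Nat.exists_eq_succ_of_ne_zero hN.ne'
      rw [ha] at hE
      exact hQ M hE
  have hfac : ∀ j : ℕ, ratio j ^ 2 - f j =
      x ^ (2 * j - 2 * N - 2 : ℤ) * ((1 - x ^ (2 * (j + 1)))⁻¹ ^ 2) *
        (1 - x ^ (2 * N + 1)) ^ 2 := fun j => by
    have e1 : x ^ (2 * j - 1 : ℤ) = (x ^ j) ^ 2 * x⁻¹ := by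
      rw [zpow_sub_one₀ hX, ← pow_mul, mul_comm j 2]; exact_mod_cast rfl
    have e2 : a = (x ^ N) ^ 2 := by
      simp only [a]
      rw [← pow_mul, mul_comm N 2]; exact_mod_cast rfl
    have e3 : b = (x ^ N)⁻¹ ^ 2 * x⁻¹ ^ 2 := by
      have := pow_ne_zero N hX
      rw [e2] at hab
      field_simp
      linear_combination hab
    have e4 : x ^ (2 * j - 2 * N - 2 : ℤ) = (x ^ j) ^ 2 * b := by
      simp only [b]
      rw [← pow_mul, ← zpow_natCast, ← zpow_add₀ hX]
      congr 1
      push_cast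
      ring
    have hden := hQ j
    have hxN := pow_ne_zero N hX
    rw [e4]
    simp only [f, ratio, ← hx]
    rw [e1, e3, e2, ← pow_mul x 2 (j + 1), ← pow_mul x 2 j, mul_comm 2 j, pow_mul x j 2]
    rw [← pow_mul] at hden
    rw [pow_succ x (2 * N), mul_comm 2 N, pow_mul x N 2]
    field_simp
    ring
  rw [← sub_zero (∑ k ∈ range (N + 2), summand k), ← hzero, ← sum_sub_distrib]
  refine CongrZero.sum fun k hk => ?_
  rw [summand, ← hx, pow_mul, ← sub_mul, mul_comm, ← prod_pow]
  have hk' := mem_range.1 hk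
  have hr : ∀ i ∈ range k, ratio i ^ 2 ∈ localSubring (cyclotomic (2 * N + 1) ℚ ^ 2) := by
    intro i hi
    have hi' := mem_range.1 hi
    refine pow_mem (ratio_mem_localSubring hodd fun h => ?_) 2
    have := Nat.le_of_dvd (by omega) h
    omega
  have hdiff : ∀ i ∈ range k, CongrZero (ratio i ^ 2 - f i) (cyclotomic (2 * N + 1) ℚ ^ 2) := by
    intro i hi
    have hi' := mem_range.1 hi
    rw [hfac]
    refine CongrZero.mul_left (Subring.mul_mem _ (X_zpow_mem_localSubring hodd.pos _)
      (pow_mem (inv_one_sub_X_pow_mem_localSubring hodd.pos (not_dvd_two_mul hodd fun h => ?_)) 2))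
      ?_
    · have := Nat.le_of_dvd (by omega) h
      omega
    · simpa using CongrZero.of_dvd (pow_dvd_pow_of_dvd
        (cyclotomic_dvd_one_sub_X_pow (dvd_refl (2 * N + 1))) 2)
  refine CongrZero.mul_left (pow_mem (pow_mem (X_mem_localSubring _) 2) k)
    (CongrZero.prod_sub_prod hr (fun i hi => ?_) hdiff)
  obtain ⟨B, hB, hB'⟩ := hdiff i hi
  rw [show f i = ratio i ^ 2 - (ratio i ^ 2 - f i) by ring, hB]
  exact Subring.sub_mem _ (hr i hi)
    (Subring.mul_mem _ (algebraMap_mem_localSubring _ _) hB')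

theorem congrZero_ratio_add_sub (hodd : Odd d) (u : ℕ) {j : ℕ} (hj : j + 1 < d) :
    CongrZero (ratio (d * u + j) - ratio j) (cyclotomic d ℚ ^ 1) := by
  have hX : (RatFunc.X : RatFunc ℚ) ≠ 0 := RatFunc.X_ne_zero
  have hdvd : ¬ d ∣ j + 1 := fun h => by
    have := Nat.le_of_dvd (by omega) h
    omega
  have hdvd' : ¬ d ∣ d * u + j + 1 := by
    rwa [add_assoc, Nat.dvd_add_right (dvd_mul_right d u)]
  have hnum : (RatFunc.X : RatFunc ℚ) ^ (2 * (d * u + j : ℕ) - 1 : ℤ) =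
      RatFunc.X ^ (2 * (d * u)) * RatFunc.X ^ (2 * j - 1 : ℤ) := by
    rw [← zpow_natCast, ← zpow_add₀ hX]
    congr 1
    push_cast
    ring
  have hden : (RatFunc.X : RatFunc ℚ) ^ (2 * (d * u + j + 1)) =
      RatFunc.X ^ (2 * (d * u)) * RatFunc.X ^ (2 * (j + 1)) := by ring
  have h1 := one_sub_X_pow_ne_zero (m := 2 * (j + 1)) (by omega)
  have h2 := one_sub_X_pow_ne_zero (m := 2 * (d * u + j + 1)) (by omega)
  have hsub : ratio (d * u + j) - ratio j =
      (RatFunc.X ^ (2 * j - 1 : ℤ) - RatFunc.X ^ (2 * (j + 1))) *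
        (1 - RatFunc.X ^ (2 * (d * u + j + 1)))⁻¹ * (1 - RatFunc.X ^ (2 * (j + 1)))⁻¹ *
        (1 - RatFunc.X ^ (2 * (d * u))) := by
    simp only [ratio]
    rw [hnum]
    rw [hden] at h2 ⊢
    generalize (RatFunc.X : RatFunc ℚ) ^ (2 * (d * u)) = y at *
    generalize (RatFunc.X : RatFunc ℚ) ^ (2 * (j + 1)) = z at *
    generalize (RatFunc.X : RatFunc ℚ) ^ (2 * j - 1 : ℤ) = w at *
    field_simp
    ring
  rw [hsub]
  refine CongrZero.mul_left (Subring.mul_mem _ (Subring.mul_mem _ (Subring.sub_mem _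
    (X_zpow_mem_localSubring hodd.pos _) (pow_mem (X_mem_localSubring _) _))
    (inv_one_sub_X_pow_mem_localSubring hodd.pos (not_dvd_two_mul hodd hdvd')))
    (inv_one_sub_X_pow_mem_localSubring hodd.pos (not_dvd_two_mul hodd hdvd))) ?_
  rw [pow_one]
  simpa using CongrZero.of_dvd
    (cyclotomic_dvd_one_sub_X_pow (dvd_mul_of_dvd_right (dvd_mul_right d u) 2))

theorem one_sub_X_pow_div_mem_localSubring (hd : 0 < d) (k : ℕ) {m : ℕ} (hm : m ≠ 0) :
    (1 - (RatFunc.X : RatFunc ℚ) ^ (d * k)) * (1 - RatFunc.X ^ (d * m))⁻¹ ∈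
      localSubring (cyclotomic d ℚ ^ e) := by
  have hgeom : ∀ k : ℕ, 1 - (RatFunc.X : RatFunc ℚ) ^ (d * k) =
      (1 - RatFunc.X ^ d) * algebraMap ℚ[X] (RatFunc ℚ) (∑ i ∈ range k, (X ^ d) ^ i) := by
    intro k
    simp only [map_sum, map_pow, RatFunc.algebraMap_X]
    rw [mul_neg_geom_sum, pow_mul]
  rw [hgeom, hgeom, mul_inv, mul_mul_mul_comm, mul_inv_cancel₀ (one_sub_X_pow_ne_zero hd.ne'),
    one_mul]
  exact Subring.mul_mem _ (algebraMap_mem_localSubring _ _)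
    (inv_algebraMap_mem_localSubring ((isCoprime_geom_sum_cyclotomic hd hm).pow_right))

theorem prod_ratio_block_mem_localSubring (hd : 1 < d) (hodd : Odd d) (u : ℕ) :
    ∏ j ∈ range d, ratio (d * u + j) ∈ localSubring (cyclotomic d ℚ ^ e) := by
  have hpos : 0 < d := hodd.pos
  obtain ⟨N, hN⟩ := hodd
  have hmid : N + 1 ∈ range d := mem_range.2 (by omega)
  have hlast : d - 1 ∈ range d := mem_range.2 (by omega)
  simp only [ratio, prod_mul_distrib]
  rw [← mul_prod_erase _ _ hmid, ← mul_prod_erase _ _ hlast, mul_mul_mul_comm]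
  refine Subring.mul_mem _ ?_ (Subring.mul_mem _
    (Subring.prod_mem _ fun j _ => one_sub_X_zpow_mem_localSubring hpos _)
    (Subring.prod_mem _ fun j hj => inv_one_sub_X_pow_mem_localSubring hpos
      (not_dvd_two_mul ⟨N, hN⟩ ?_)))
  · have h1 : (2 * (d * u + (N + 1) : ℕ) - 1 : ℤ) = (d * (2 * u + 1) : ℕ) := by
      subst hN
      push_cast
      ring
    have h2 : 2 * (d * u + (d - 1) + 1) = d * (2 * (u + 1)) := by
      rw [add_assoc, Nat.sub_add_cancel hpos]
      ring
    rw [h1, h2, zpow_natCast]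
    exact one_sub_X_pow_div_mem_localSubring hpos _ (by omega)
  · simp only [mem_erase, mem_range] at hj
    rw [add_assoc, Nat.dvd_add_right (dvd_mul_right d u)]
    intro h
    have := Nat.le_of_dvd (by omega) h
    omega

theorem prod_ratio_mem_localSubring (hd : 1 < d) (hodd : Odd d) (u : ℕ) :
    ∏ j ∈ range (d * u), ratio j ∈ localSubring (cyclotomic d ℚ ^ e) := by
  induction u with
  | zero => simp
  | succ u ih =>
    rw [Nat.mul_succ, prod_range_add]
    exact Subring.mul_mem _ ih (prod_ratio_block_mem_localSubring hd hodd u)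

theorem prod_ratio_mem_localSubring_of_lt (hodd : Odd d) {v : ℕ} (hv : v < d) :
    ∏ j ∈ range v, ratio j ∈ localSubring (cyclotomic d ℚ ^ e) := by
  refine Subring.prod_mem _ fun j hj => ratio_mem_localSubring hodd fun h => ?_
  have := mem_range.1 hj
  have := Nat.le_of_dvd (by omega) h
  omega

theorem prod_ratio_shift_mem_localSubring_of_lt (hodd : Odd d) (u : ℕ) {v : ℕ} (hv : v < d) :
    ∏ j ∈ range v, ratio (d * u + j) ∈ localSubring (cyclotomic d ℚ ^ e) := by
  refine Subring.prod_mem _ fun j hj => ratio_mem_localSubring hodd ?_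
  rw [add_assoc, Nat.dvd_add_right (dvd_mul_right d u)]
  intro h
  have := mem_range.1 hj
  have := Nat.le_of_dvd (by omega) h
  omega

theorem congrZero_summand_of_lt (hodd : Odd d) {k : ℕ} (hk : (d + 1) / 2 < k) (hk' : k < d) :
    CongrZero (summand k) (cyclotomic d ℚ ^ 1) := by
  have hpos : 0 < d := hodd.pos
  obtain ⟨N, hN⟩ := id hodd
  have hmid : N + 1 ∈ range k := mem_range.2 (by omega)
  have hdvd : ∀ j < k, ¬ d ∣ j + 1 := fun j hj h => by
    have := Nat.le_of_dvd (by omega) h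
    omega
  have hz : (2 * (N + 1 : ℕ) - 1 : ℤ) = d := by
    subst hN
    push_cast
    ring
  have hfac : summand k = (RatFunc.X ^ (2 * k) * (∏ j ∈ range k, ratio j) *
      (∏ j ∈ (range k).erase (N + 1), ratio j) * (1 - RatFunc.X ^ (2 * (N + 1 + 1)))⁻¹) *
        (1 - RatFunc.X ^ d) := by
    rw [summand, sq]
    nth_rewrite 2 [← mul_prod_erase _ _ hmid]
    rw [ratio, hz, zpow_natCast]
    ring
  rw [hfac]
  refine CongrZero.mul_left (Subring.mul_mem _ (Subring.mul_mem _ (Subring.mul_mem _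
    (pow_mem (X_mem_localSubring _) _) (prod_ratio_mem_localSubring_of_lt hodd hk'))
    (Subring.prod_mem _ fun j hj =>
      ratio_mem_localSubring hodd (hdvd j (mem_range.1 (mem_of_mem_erase hj)))))
    (inv_one_sub_X_pow_mem_localSubring hpos
      (not_dvd_two_mul hodd (hdvd _ (mem_range.1 hmid))))) ?_
  rw [pow_one]
  simpa using CongrZero.of_dvd (cyclotomic_dvd_one_sub_X_pow (dvd_refl d))

theorem congrZero_sum_summand_range (hd : 1 < d) (hodd : Odd d) {L : ℕ}
    (hL : (d + 1) / 2 + 1 ≤ L) (hL' : L ≤ d) :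
    CongrZero (∑ k ∈ range L, summand k) (cyclotomic d ℚ ^ 1) := by
  rw [← sum_range_add_sum_Ico _ hL]
  refine ((congrZero_sum_summand_sq hd hodd).mono (pow_dvd_pow _ one_le_two)).add
    (CongrZero.sum fun k hk => ?_)
  rw [mem_Ico] at hk
  exact congrZero_summand_of_lt hodd (by omega) (by omega)

theorem congrZero_sum_summand_shift (hd : 1 < d) (hodd : Odd d) (u : ℕ) {L : ℕ}
    (hL : (d + 1) / 2 + 1 ≤ L) (hL' : L ≤ d) :
    CongrZero (∑ v ∈ range L, summand (d * u + v)) (cyclotomic d ℚ ^ 1) := by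
  let C : RatFunc ℚ := (∏ j ∈ range (d * u), ratio j) ^ 2 * RatFunc.X ^ (2 * (d * u))
  let D : ℕ → RatFunc ℚ := fun v => RatFunc.X ^ (2 * v) *
    (∏ j ∈ range v, ratio (d * u + j) + ∏ j ∈ range v, ratio j)
  have hC : C ∈ localSubring (cyclotomic d ℚ ^ 1) :=
    Subring.mul_mem _ (pow_mem (prod_ratio_mem_localSubring hd hodd u) 2)
      (pow_mem (X_mem_localSubring _) _)
  have hsum : ∑ v ∈ range L, summand (d * u + v) = C * (∑ v ∈ range L, summand v +
      ∑ v ∈ range L, D v * (∏ j ∈ range v, ratio (d * u + j) - ∏ j ∈ range v, ratio j)) := by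
    rw [← sum_add_distrib, mul_sum]
    refine sum_congr rfl fun v _ => ?_
    simp only [C, D, summand]
    rw [prod_range_add]
    ring
  rw [hsum]
  refine CongrZero.mul_left hC ((congrZero_sum_summand_range hd hodd hL hL').add
    (CongrZero.sum fun v hv => ?_))
  have hv' : v < d := (mem_range.1 hv).trans_le hL'
  refine CongrZero.mul_left (Subring.mul_mem _ (pow_mem (X_mem_localSubring _) _)
    (Subring.add_mem _ (prod_ratio_shift_mem_localSubring_of_lt hodd u hv')
      (prod_ratio_mem_localSubring_of_lt hodd hv'))) (CongrZero.prod_sub_prod ?_ ?_ ?_)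
  · intro j hj
    have := mem_range.1 hj
    refine ratio_mem_localSubring hodd ?_
    rw [add_assoc, Nat.dvd_add_right (dvd_mul_right d u)]
    exact fun h => by
      have := Nat.le_of_dvd (by omega) h
      omega
  · intro j hj
    have := mem_range.1 hj
    exact ratio_mem_localSubring hodd fun h => by
      have := Nat.le_of_dvd (by omega) h
      omega
  · intro j hj
    have := mem_range.1 hj
    exact congrZero_ratio_add_sub hodd u (by omega)

theorem congrZero_sum_summand_of_dvd (hd : 1 < d) {n : ℕ} (hodd : Odd n) (hdn : d ∣ n) :
    CongrZero (∑ k ∈ range ((n + 1) / 2 + 1), summand k) (cyclotomic d ℚ) := by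
  have hdodd : Odd d := hodd.of_dvd_nat hdn
  obtain ⟨m, rfl⟩ := hdn
  obtain ⟨M, rfl⟩ := (Nat.odd_mul.1 hodd).2
  have hlen : (d * (2 * M + 1) + 1) / 2 + 1 = d * M + ((d + 1) / 2 + 1) := by
    have : d * (2 * M + 1) + 1 = 2 * (d * M) + (d + 1) := by ring
    omega
  have hblocks : ∀ M : ℕ, CongrZero (∑ k ∈ range (d * M), summand k) (cyclotomic d ℚ ^ 1) := by
    intro M
    induction M with
    | zero => simpa using CongrZero.zero
    | succ M ih =>
      rw [Nat.mul_succ, sum_range_add]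
      obtain ⟨N, hN⟩ := id hdodd
      exact ih.add (congrZero_sum_summand_shift hd hdodd M (by omega) le_rfl)
  rw [hlen, sum_range_add, ← pow_one (cyclotomic d ℚ)]
  obtain ⟨N, hN⟩ := id hdodd
  exact (hblocks M).add (congrZero_sum_summand_shift hd hdodd M le_rfl (by omega))

end Ratio

theorem geom_sum_mul_cyclotomic {n : ℕ} (hn : 1 < n) :
    (∑ i ∈ range n, (X : ℚ[X]) ^ i) * cyclotomic n ℚ =
      cyclotomic n ℚ ^ 2 * ∏ d ∈ (n.divisors.erase 1).erase n, cyclotomic d ℚ := by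
  have hmem : n ∈ n.divisors.erase 1 := by simp; omega
  rw [← prod_cyclotomic_eq_geom_sum (by omega) ℚ, ← mul_prod_erase _ _ hmem]
  ring

theorem stmt4 (n : ℕ) (hn : 1 < n) (hodd : Odd n) :
    CongrZero
      (∑ k ∈ Finset.range ((n + 1) / 2 + 1),
        (qPoch ((RatFunc.X : RatFunc ℚ) ^ (-1 : ℤ)) (RatFunc.X ^ 2) k) ^ 2
            * RatFunc.X ^ (2 * k)
          / (qPoch ((RatFunc.X : RatFunc ℚ) ^ 2) (RatFunc.X ^ 2) k) ^ 2)
      ((∑ i ∈ Finset.range n, (Polynomial.X : Polynomial ℚ) ^ i)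
        * Polynomial.cyclotomic n ℚ) := by
  simp only [qPoch_div_eq_summand]
  rw [geom_sum_mul_cyclotomic hn]
  refine CongrZero.mul_modulus ?_ (congrZero_sum_summand_sq hn hodd)
    (CongrZero.prod_modulus ?_ fun d hd => ?_)
  · refine IsCoprime.prod_right fun d hd => IsCoprime.pow_left ?_
    exact cyclotomic.isCoprime_rat (ne_of_mem_erase hd).symm
  · exact fun i _ j _ hij => cyclotomic.isCoprime_rat hij
  · simp only [mem_erase, Nat.mem_divisors] at hd
    have := Nat.pos_of_dvd_of_pos hd.2.2.1 (by omega)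
    exact congrZero_sum_summand_of_dvd (by omega) hodd hd.2.2.1
end
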